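/- arXiv:1710.04322 — 3 statements merged into one kernel-verified Lean document; each statement's English description precedes it below -/
import Mathlib

section
/- Let φ be a Schwartz function on ℝ (the momentum-space wavefunction of a free quantum particle), and define its free time evolution φ_t(p) = exp(−i p² t / 2) φ(p). For x ∈ ℝ let P_t(x) = ∫_{x}^{∞} ⟨ρ_t(y)⟩ dy, where ⟨ρ_t(y)⟩ = ∫∫ conj(φ_t(p)) (1/(2π)) e^{i(q−p)y} φ_t(q) dp dq is the expected probability density. Then t ↦ P_t(x) is differentiable and (d/dt) P_t(x) = ⟨J_t(x)⟩, where ⟨J_t(x)⟩ = ∫∫ conj(φ_t(p)) ((p+q)/(4π)) e^{i(q−p)x} φ_t(q) dp dq is the expected probability flux at x. -/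
open MeasureTheory Real

open scoped ComplexConjugate

namespace FreeParticle

/-- The plane-wave phase `exp(i (p y − p² t / 2))`. -/
noncomputable def phase (t y p : ℝ) : ℂ :=
  Complex.exp (((p * y - p ^ 2 * t / 2 : ℝ) : ℂ) * Complex.I)

/-- Position-space evolution `∫ exp(i (p y − p² t / 2)) ψ(p) dp` of a momentum wavefunction. -/
noncomputable def wave (ψ : SchwartzMap ℝ ℂ) (t y : ℝ) : ℂ :=
  ∫ p : ℝ, phase t y p * ψ p

/-- Multiplication of a Schwartz function by the momentum variable. -/
noncomputable def momentum (ψ : SchwartzMap ℝ ℂ) : SchwartzMap ℝ ℂ :=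
  SchwartzMap.smulLeftCLM ℂ Complex.ofReal ψ

@[simp]
lemma momentum_apply (ψ : SchwartzMap ℝ ℂ) (p : ℝ) : momentum ψ p = p * ψ p := by
  simp [momentum, SchwartzMap.smulLeftCLM_apply_apply Function.Complex.hasTemperateGrowth_ofReal]

@[simp]
lemma norm_phase (t y p : ℝ) : ‖phase t y p‖ = 1 :=
  Complex.norm_exp_ofReal_mul_I _

lemma continuous_phase (t y : ℝ) : Continuous (phase t y) := by
  unfold phase
  fun_prop

lemma hasDerivAt_phase_momentum (t y p : ℝ) :
    HasDerivAt (phase t y) (phase t y p * ((y - p * t) * Complex.I)) p := by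
  have h : HasDerivAt (fun p : ℝ => p * y - p ^ 2 * t / 2) (y - p * t) p := by
    refine (((hasDerivAt_id p).mul_const y).sub
      ((((hasDerivAt_id p).pow 2).mul_const t).div_const 2)).congr_deriv ?_
    simp
    ring
  exact (h.ofReal_comp.mul_const Complex.I).cexp.congr_deriv (by simp [phase])

lemma hasDerivAt_phase_position (t y p : ℝ) :
    HasDerivAt (fun y => phase t y p) (phase t y p * (p * Complex.I)) y := by
  have h : HasDerivAt (fun y : ℝ => p * y - p ^ 2 * t / 2) p y := by
    simpa using ((hasDerivAt_id y).const_mul p).sub_const (p ^ 2 * t / 2)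
  exact (h.ofReal_comp.mul_const Complex.I).cexp

lemma hasDerivAt_phase_time (t y p : ℝ) :
    HasDerivAt (fun t => phase t y p) (phase t y p * (-(p ^ 2 / 2) * Complex.I)) t := by
  have h : HasDerivAt (fun t : ℝ => p * y - p ^ 2 * t / 2) (-(p ^ 2 / 2)) t := by
    refine ((((hasDerivAt_id t).const_mul (p ^ 2)).div_const 2).const_sub (p * y)).congr_deriv ?_
    simp
  exact (h.ofReal_comp.mul_const Complex.I).cexp.congr_deriv (by simp [phase])

lemma integrable_phase_mul (ψ : SchwartzMap ℝ ℂ) (t y : ℝ) :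
    Integrable (fun p => phase t y p * ψ p) :=
  ψ.integrable.bdd_mul (c := 1) (continuous_phase t y).aestronglyMeasurable
    (Filter.Eventually.of_forall fun p => (norm_phase t y p).le)

lemma norm_wave_le (ψ : SchwartzMap ℝ ℂ) (t y : ℝ) : ‖wave ψ t y‖ ≤ ∫ p, ‖ψ p‖ := by
  refine (norm_integral_le_integral_norm _).trans_eq ?_
  simp

lemma hasDerivAt_wave_position (ψ : SchwartzMap ℝ ℂ) (t y : ℝ) :
    HasDerivAt (wave ψ t) (Complex.I * wave (momentum ψ) t y) y := by
  have h := (hasDerivAt_integral_of_dominated_loc_of_deriv_le (μ := volume)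
    (F := fun y p => phase t y p * ψ p)
    (F' := fun y p => Complex.I * (phase t y p * momentum ψ p))
    (bound := fun p => ‖momentum ψ p‖) (x₀ := y) Filter.univ_mem
    (Filter.Eventually.of_forall fun y => (integrable_phase_mul ψ t y).aestronglyMeasurable)
    (integrable_phase_mul ψ t y)
    ((integrable_phase_mul (momentum ψ) t y).const_mul _).aestronglyMeasurable
    (Filter.Eventually.of_forall fun p y _ => by simp)
    (momentum ψ).integrable.norm
    (Filter.Eventually.of_forall fun p y _ =>
      ((hasDerivAt_phase_position t y p).mul_const (ψ p)).congr_deriv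
        (by rw [momentum_apply]; ring))).2
  rwa [integral_const_mul] at h

lemma hasDerivAt_wave_time (ψ : SchwartzMap ℝ ℂ) (t y : ℝ) :
    HasDerivAt (fun t => wave ψ t y)
      (-(Complex.I / 2) * wave (momentum (momentum ψ)) t y) t := by
  have h := (hasDerivAt_integral_of_dominated_loc_of_deriv_le (μ := volume)
    (F := fun t p => phase t y p * ψ p)
    (F' := fun t p => -(Complex.I / 2) * (phase t y p * momentum (momentum ψ) p))
    (bound := fun p => ‖momentum (momentum ψ) p‖) (x₀ := t) Filter.univ_mem
    (Filter.Eventually.of_forall fun t => (integrable_phase_mul ψ t y).aestronglyMeasurable)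
    (integrable_phase_mul ψ t y)
    ((integrable_phase_mul (momentum (momentum ψ)) t y).const_mul _).aestronglyMeasurable
    (Filter.Eventually.of_forall fun p t _ => by
      rw [norm_mul, norm_mul, norm_phase, one_mul, norm_neg, norm_div, Complex.norm_I,
        Complex.norm_ofNat]
      nlinarith [norm_nonneg (momentum (momentum ψ) p)])
    (momentum (momentum ψ)).integrable.norm
    (Filter.Eventually.of_forall fun p t _ =>
      ((hasDerivAt_phase_time t y p).mul_const (ψ p)).congr_deriv
        (by simp only [momentum_apply]; ring))).2
  rwa [integral_const_mul] at h

/-- Integration by parts in momentum space. -/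
lemma position_mul_wave (ψ : SchwartzMap ℝ ℂ) (t y : ℝ) :
    Complex.I * y * wave ψ t y =
      Complex.I * t * wave (momentum ψ) t y - wave (SchwartzMap.derivCLM ℂ ℂ ψ) t y := by
  have hi (ψ) := integrable_phase_mul ψ t y
  have key := integral_eq_zero_of_hasDerivAt_of_integrable
    (f := fun p => phase t y p * ψ p)
    (f' := fun p => Complex.I * y * (phase t y p * ψ p)
      - Complex.I * t * (phase t y p * momentum ψ p)
      + phase t y p * SchwartzMap.derivCLM ℂ ℂ ψ p)
    (fun p => ((hasDerivAt_phase_momentum t y p).mul (ψ.hasDerivAt p)).congr_deriv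
      (by rw [momentum_apply, SchwartzMap.derivCLM_apply]; ring))
    ((((hi ψ).const_mul _).sub ((hi _).const_mul _)).add (hi _)) (hi ψ)
  rw [integral_add (by exact ((hi ψ).const_mul _).sub ((hi _).const_mul _)) (hi _),
    integral_sub ((hi ψ).const_mul _) ((hi _).const_mul _), integral_const_mul,
    integral_const_mul] at key
  unfold wave
  linear_combination key

lemma exists_one_add_abs_mul_norm_wave_le (ψ : SchwartzMap ℝ ℂ) (T : ℝ) :
    ∃ C, ∀ t y, |t| ≤ T → (1 + |y|) * ‖wave ψ t y‖ ≤ C := by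
  refine ⟨(∫ p, ‖ψ p‖) + (T * (∫ p, ‖momentum ψ p‖) +
    ∫ p, ‖SchwartzMap.derivCLM ℂ ℂ ψ p‖), fun t y ht => ?_⟩
  rw [add_mul, one_mul]
  refine add_le_add (norm_wave_le ψ t y) ?_
  calc |y| * ‖wave ψ t y‖ = ‖Complex.I * y * wave ψ t y‖ := by simp
    _ ≤ ‖Complex.I * t * wave (momentum ψ) t y‖ + ‖wave (SchwartzMap.derivCLM ℂ ℂ ψ) t y‖ := by
      rw [position_mul_wave]
      exact norm_sub_le _ _
    _ = |t| * ‖wave (momentum ψ) t y‖ + ‖wave (SchwartzMap.derivCLM ℂ ℂ ψ) t y‖ := by simp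
    _ ≤ _ := by
      gcongr
      · exact (abs_nonneg t).trans ht
      · exact norm_wave_le _ _ _
      · exact norm_wave_le _ _ _

lemma exists_norm_wave_mul_norm_wave_le (ψ χ : SchwartzMap ℝ ℂ) (T : ℝ) :
    ∃ C, ∀ t y, |t| ≤ T → ‖wave ψ t y‖ * ‖wave χ t y‖ ≤ C * (1 + y ^ 2)⁻¹ := by
  obtain ⟨A, hA⟩ := exists_one_add_abs_mul_norm_wave_le ψ T
  obtain ⟨B, hB⟩ := exists_one_add_abs_mul_norm_wave_le χ T
  refine ⟨A * B, fun t y ht => ?_⟩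
  rw [← div_eq_mul_inv, le_div_iff₀ (by positivity)]
  calc ‖wave ψ t y‖ * ‖wave χ t y‖ * (1 + y ^ 2)
      ≤ ‖wave ψ t y‖ * ‖wave χ t y‖ * (1 + |y|) ^ 2 := by
        gcongr
        nlinarith [sq_abs y, abs_nonneg y]
    _ = ((1 + |y|) * ‖wave ψ t y‖) * ((1 + |y|) * ‖wave χ t y‖) := by ring
    _ ≤ A * B := by
      have hA' := hA t y ht
      gcongr
      · exact le_trans (by positivity) hA'
      · exact hB t y ht

/-- The expected probability density in terms of the position-space wave. -/
noncomputable def density (φ : SchwartzMap ℝ ℂ) (t y : ℝ) : ℂ :=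
  1 / (2 * π) * (conj (wave φ t y) * wave φ t y)

/-- The expected probability flux in terms of the position-space wave. -/
noncomputable def flux (φ : SchwartzMap ℝ ℂ) (t y : ℝ) : ℂ :=
  1 / (4 * π) * (conj (wave (momentum φ) t y) * wave φ t y +
    conj (wave φ t y) * wave (momentum φ) t y)

/-- The common value of `∂ₜ density` and `-∂ᵧ flux`. -/
noncomputable def densityRate (φ : SchwartzMap ℝ ℂ) (t y : ℝ) : ℂ :=
  Complex.I / (4 * π) * (conj (wave (momentum (momentum φ)) t y) * wave φ t y -
    conj (wave φ t y) * wave (momentum (momentum φ)) t y)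

lemma hasDerivAt_density (φ : SchwartzMap ℝ ℂ) (t y : ℝ) :
    HasDerivAt (fun t => density φ t y) (densityRate φ t y) t := by
  have h := hasDerivAt_wave_time φ t y
  refine ((h.star.mul h).const_mul (1 / (2 * π : ℂ))).congr_deriv ?_
  simp only [densityRate, starRingEnd_apply, star_mul', star_neg, star_div₀, star_ofNat]
  rw [← starRingEnd_apply Complex.I, Complex.conj_I]
  field_simp
  ring

lemma hasDerivAt_flux (φ : SchwartzMap ℝ ℂ) (t y : ℝ) :
    HasDerivAt (flux φ t) (-densityRate φ t y) y := by
  have h := hasDerivAt_wave_position φ t y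
  have h' := hasDerivAt_wave_position (momentum φ) t y
  refine (((h'.star.mul h).add (h.star.mul h')).const_mul (1 / (4 * π : ℂ))).congr_deriv ?_
  simp only [densityRate, starRingEnd_apply, star_mul']
  rw [← starRingEnd_apply Complex.I, Complex.conj_I]
  field_simp
  ring

lemma continuous_wave (ψ : SchwartzMap ℝ ℂ) (t : ℝ) : Continuous (wave ψ t) :=
  continuous_iff_continuousAt.2 fun y => (hasDerivAt_wave_position ψ t y).continuousAt

lemma continuous_density (φ : SchwartzMap ℝ ℂ) (t : ℝ) : Continuous (density φ t) :=
  continuous_const.mul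
    ((Complex.continuous_conj.comp (continuous_wave φ t)).mul (continuous_wave φ t))

lemma continuous_densityRate (φ : SchwartzMap ℝ ℂ) (t : ℝ) : Continuous (densityRate φ t) := by
  have h := continuous_wave φ t
  have h' := continuous_wave (momentum (momentum φ)) t
  exact continuous_const.mul (((Complex.continuous_conj.comp h').mul h).sub
    ((Complex.continuous_conj.comp h).mul h'))

lemma exists_norm_densityRate_le (φ : SchwartzMap ℝ ℂ) (T : ℝ) :
    ∃ C, ∀ t y, |t| ≤ T → ‖densityRate φ t y‖ ≤ C * (1 + y ^ 2)⁻¹ := by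
  obtain ⟨C, hC⟩ := exists_norm_wave_mul_norm_wave_le φ (momentum (momentum φ)) T
  refine ⟨‖Complex.I / (4 * π)‖ * (2 * C), fun t y ht => ?_⟩
  rw [densityRate, norm_mul, mul_assoc]
  gcongr
  refine (norm_sub_le _ _).trans ?_
  simp only [norm_mul, RCLike.norm_conj]
  linarith [hC t y ht]

lemma integrable_density (φ : SchwartzMap ℝ ℂ) (t : ℝ) : Integrable (density φ t) := by
  obtain ⟨C, hC⟩ := exists_norm_wave_mul_norm_wave_le φ φ |t|
  refine ((integrable_inv_one_add_sq.const_mul C).const_mul ‖(1 / (2 * π) : ℂ)‖).mono'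
    (continuous_density φ t).aestronglyMeasurable (Filter.Eventually.of_forall fun y => ?_)
  rw [density, norm_mul, norm_mul (conj _), RCLike.norm_conj]
  exact mul_le_mul_of_nonneg_left (hC t y le_rfl) (norm_nonneg _)

lemma tendsto_flux_atTop (φ : SchwartzMap ℝ ℂ) (t : ℝ) :
    Filter.Tendsto (flux φ t) Filter.atTop (nhds 0) := by
  obtain ⟨C, hC⟩ := exists_norm_wave_mul_norm_wave_le φ (momentum φ) |t|
  have hlim : Filter.Tendsto (fun y : ℝ => ‖(1 / (4 * π) : ℂ)‖ * (2 * C * (1 + y ^ 2)⁻¹))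
      Filter.atTop (nhds 0) := by
    have : Filter.Tendsto (fun y : ℝ => 1 + y ^ 2) Filter.atTop Filter.atTop :=
      Filter.tendsto_atTop_add_const_left _ _ (Filter.tendsto_pow_atTop two_ne_zero)
    simpa using (this.inv_tendsto_atTop.const_mul (2 * C)).const_mul ‖(1 / (4 * π) : ℂ)‖
  refine squeeze_zero_norm (fun y => ?_) hlim
  rw [flux, norm_mul]
  gcongr
  refine (norm_add_le _ _).trans ?_
  simp only [norm_mul, RCLike.norm_conj]
  linarith [hC t y le_rfl]

lemma hasDerivAt_integral_density (φ : SchwartzMap ℝ ℂ) (t x : ℝ) :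
    HasDerivAt (fun t => ∫ y in Set.Ioi x, density φ t y) (flux φ t x) t := by
  obtain ⟨C, hC⟩ := exists_norm_densityRate_le φ (|t| + 1)
  have habs {s : ℝ} (hs : s ∈ Metric.ball t 1) : |s| ≤ |t| + 1 := by
    rw [Metric.mem_ball, Real.dist_eq] at hs
    linarith [abs_sub_abs_le_abs_sub s t]
  obtain ⟨hint, hderiv⟩ := hasDerivAt_integral_of_dominated_loc_of_deriv_le
    (μ := volume.restrict (Set.Ioi x)) (F := density φ) (F' := densityRate φ)
    (bound := fun y => C * (1 + y ^ 2)⁻¹) (Metric.ball_mem_nhds t one_pos)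
    (Filter.Eventually.of_forall fun s => (continuous_density φ s).aestronglyMeasurable)
    (integrable_density φ t).integrableOn
    (continuous_densityRate φ t).aestronglyMeasurable
    (Filter.Eventually.of_forall fun y s hs => hC s y (habs hs))
    (integrable_inv_one_add_sq.const_mul C).integrableOn
    (Filter.Eventually.of_forall fun y s _ => hasDerivAt_density φ s y)
  have hFTC := integral_Ioi_of_hasDerivAt_of_tendsto' (a := x)
    (fun y _ => hasDerivAt_flux φ t y) hint.neg (tendsto_flux_atTop φ t)
  rw [integral_neg, zero_sub, neg_inj] at hFTC
  rwa [hFTC] at hderiv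

lemma conj_evolution_mul_evolution (φ : SchwartzMap ℝ ℂ) (t y p q : ℝ) (c : ℂ) :
    conj (Complex.exp (-Complex.I * (p : ℂ) ^ 2 * (t : ℂ) / 2) * φ p) * c *
        Complex.exp (Complex.I * ((q : ℂ) - (p : ℂ)) * (y : ℂ)) *
        (Complex.exp (-Complex.I * (q : ℂ) ^ 2 * (t : ℂ) / 2) * φ q) =
      c * (conj (phase t y p * φ p) * (phase t y q * φ q)) := by
  have h : conj (Complex.exp (-Complex.I * (p : ℂ) ^ 2 * (t : ℂ) / 2)) *
      Complex.exp (Complex.I * ((q : ℂ) - (p : ℂ)) * (y : ℂ)) *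
      Complex.exp (-Complex.I * (q : ℂ) ^ 2 * (t : ℂ) / 2) =
      conj (phase t y p) * phase t y q := by
    simp only [phase, ← Complex.exp_conj, ← Complex.exp_add]
    congr 1
    simp
    ring
  simp only [map_mul]
  linear_combination c * conj (φ p) * φ q * h

lemma integral_integral_eq_density (φ : SchwartzMap ℝ ℂ) (t y : ℝ) :
    ∫ p : ℝ, ∫ q : ℝ, 1 / (2 * (π : ℂ)) * (conj (phase t y p * φ p) * (phase t y q * φ q)) =
      density φ t y := by
  simp only [integral_const_mul, integral_mul_const, integral_conj, density, wave]

lemma integral_integral_eq_flux (φ : SchwartzMap ℝ ℂ) (t y : ℝ) :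
    ∫ p : ℝ, ∫ q : ℝ, ((p : ℂ) + (q : ℂ)) / (4 * (π : ℂ)) *
        (conj (phase t y p * φ p) * (phase t y q * φ q)) = flux φ t y := by
  have hi (ψ) := integrable_phase_mul ψ t y
  have hc (ψ : SchwartzMap ℝ ℂ) : Integrable (fun p => conj (phase t y p * ψ p)) :=
    Complex.conjLIE.integrable_comp_iff.2 (hi ψ)
  have hinner (p : ℝ) : ∫ q : ℝ, ((p : ℂ) + (q : ℂ)) / (4 * (π : ℂ)) *
        (conj (phase t y p * φ p) * (phase t y q * φ q)) =
      1 / (4 * π) * (conj (phase t y p * momentum φ p) * wave φ t y +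
        conj (phase t y p * φ p) * wave (momentum φ) t y) := by
    rw [wave, wave, ← integral_const_mul, ← integral_const_mul,
      ← integral_add ((hi _).const_mul _) ((hi _).const_mul _), ← integral_const_mul]
    refine integral_congr_ae (Filter.Eventually.of_forall fun q => ?_)
    simp only [momentum_apply, map_mul, Complex.conj_ofReal]
    ring
  simp only [hinner]
  rw [integral_const_mul, integral_add ((hc _).mul_const _) ((hc _).mul_const _),
    integral_mul_const, integral_mul_const, integral_conj, integral_conj]
  rfl

end FreeParticle

/-- **Integrated continuity equation for the free quantum particle.**
For a Schwartz momentum wavefunction `φ` with free time evolution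
`φ_t(p) = exp(−i p² t/2) φ(p)`, the probability `P_t(x) = ∫_{x}^{∞} ⟨ρ_t(y)⟩ dy` of
finding the particle to the right of `x` is differentiable in `t` with derivative the
expected flux `⟨J_t(x)⟩`. -/
theorem quantum_integrated_continuity
    (φ : SchwartzMap ℝ ℂ)
    (φt : ℝ → ℝ → ℂ)
    (hφt : ∀ t p, φt t p = Complex.exp (-Complex.I * (p : ℂ) ^ 2 * (t : ℂ) / 2) * φ p)
    (ρ : ℝ → ℝ → ℂ)
    (hρ : ∀ t y, ρ t y = ∫ p : ℝ, ∫ q : ℝ,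
      (starRingEnd ℂ) (φt t p) * (1 / (2 * (π : ℂ))) *
        Complex.exp (Complex.I * ((q : ℂ) - (p : ℂ)) * (y : ℂ)) * φt t q)
    (J : ℝ → ℝ → ℂ)
    (hJ : ∀ t x, J t x = ∫ p : ℝ, ∫ q : ℝ,
      (starRingEnd ℂ) (φt t p) * (((p : ℂ) + (q : ℂ)) / (4 * (π : ℂ))) *
        Complex.exp (Complex.I * ((q : ℂ) - (p : ℂ)) * (x : ℂ)) * φt t q)
    (P : ℝ → ℝ → ℂ)
    (hP : ∀ t x, P t x = ∫ y in Set.Ioi x, ρ t y) :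
    ∀ t x : ℝ, HasDerivAt (fun s : ℝ => P s x) (J t x) t := by
  intro t x
  have hρ' : ρ = FreeParticle.density φ := by
    ext s y
    simp only [hρ, hφt, FreeParticle.conj_evolution_mul_evolution,
      FreeParticle.integral_integral_eq_density]
  have hJ' : J t x = FreeParticle.flux φ t x := by
    simp only [hJ, hφt, FreeParticle.conj_evolution_mul_evolution,
      FreeParticle.integral_integral_eq_flux]
  simp only [hP, hρ', hJ']
  exact FreeParticle.hasDerivAt_integral_density φ t x
end

section
/- (Eveson–Fewster–Verch quantum inequality.) For every Schwartz function f on ℝ with f ≥ 0, there exists a constant c_f ≥ 0 such that for every momentum-space wavefunction φ ∈ L²(ℝ) that is smooth with compact support contained in the open half-line (0, ∞), the smeared flux expectation satisfies ⟨J_f⟩_φ = ∫∫ conj(φ(p)) · ((p+q)/2) · (1/(2π)) · f̂(p−q) · φ(q) dp dq ≥ −c_f · ‖φ‖², where f̂(k) = ∫ f(x) e^{−ikx} dx and ‖φ‖ is the L² norm. -/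
open MeasureTheory Real
open scoped FourierTransform SchwartzMap ContDiff

lemma lintegral_mul_sq_le {f g : ℝ → ENNReal} (hf : AEMeasurable f) (hg : AEMeasurable g) :
    (∫⁻ x, f x * g x) ^ 2 ≤ (∫⁻ x, f x ^ 2) * ∫⁻ x, g x ^ 2 := by
  have h := ENNReal.lintegral_mul_le_Lp_mul_Lq volume
    (show Real.HolderConjugate 2 2 from Real.HolderConjugate.two_two) hf hg
  calc _ ≤ _ := pow_le_pow_left' h 2
    _ = _ := by
      rw [mul_pow, ← ENNReal.rpow_natCast, ← ENNReal.rpow_natCast, ← ENNReal.rpow_mul,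
        ← ENNReal.rpow_mul]
      norm_num

lemma lintegral_neg_mul_lintegral_le {e : ℝ → ENNReal} (he : Measurable e) :
    ∫⁻ k, ENNReal.ofReal (-k) * ∫⁻ q in Set.Ioi (0 : ℝ), e (k - q) ≤
      ∫⁻ s, ENNReal.ofReal (s ^ 2) * e s := by
  have hW (k : ℝ) : ENNReal.ofReal (-k) * ∫⁻ q in Set.Ioi (0 : ℝ), e (k - q) =
      ∫⁻ s, (Set.Ioi s).indicator (fun k => ENNReal.ofReal (-k)) k * e s := by
    rw [← lintegral_indicator measurableSet_Ioi,
      ← lintegral_sub_left_eq_self (fun s => (Set.Ioi s).indicator _ k * e s) k,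
      ← lintegral_const_mul' _ _ ENNReal.ofReal_ne_top]
    refine lintegral_congr fun q => ?_
    by_cases hq : 0 < q <;> simp [Set.indicator, hq]
  simp_rw [hW]
  rw [lintegral_lintegral_swap]
  · refine lintegral_mono fun s => ?_
    dsimp only
    rw [lintegral_mul_const]
    · gcongr
      calc ∫⁻ k, (Set.Ioi s).indicator (fun k => ENNReal.ofReal (-k)) k
          ≤ ∫⁻ k, (Set.Ioo s 0).indicator (fun _ => ENNReal.ofReal (-s)) k := by
            refine lintegral_mono fun k => ?_
            by_cases hs : s < k <;> by_cases hk : k < 0 <;> simp [Set.indicator, hs, hk]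
            · exact ENNReal.ofReal_le_ofReal (by linarith)
            · linarith
        _ = ENNReal.ofReal (-s) * ENNReal.ofReal (-s) := by
            rw [lintegral_indicator measurableSet_Ioo]
            simp
        _ ≤ ENNReal.ofReal (s ^ 2) := by
            rcases le_total s 0 with h | h
            · rw [← ENNReal.ofReal_mul (by linarith)]
              exact ENNReal.ofReal_le_ofReal (by nlinarith)
            · simp [ENNReal.ofReal_of_nonpos (neg_nonpos.2 h)]
    · exact (by fun_prop : Measurable fun k : ℝ => ENNReal.ofReal (-k)).indicator measurableSet_Ioi
  · have : (Function.uncurry fun k s : ℝ =>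
        (Set.Ioi s).indicator (fun k => ENNReal.ofReal (-k)) k * e s) =
        fun z => {z : ℝ × ℝ | z.2 < z.1}.indicator (fun z => ENNReal.ofReal (-z.1)) z * e z.2 := by
      ext z
      simp [Function.uncurry, Set.indicator]
    rw [this]
    refine Measurable.aemeasurable (Measurable.mul (Measurable.indicator (by fun_prop) ?_) ?_)
    · exact measurableSet_lt measurable_snd measurable_fst
    · fun_prop

/-- Convolution with a kernel maps a function supported in the positive half-line to one whose
first negative moment is controlled by the second moment of the kernel. -/
lemma neg_le_integral_mul_norm_sq {G φ : ℝ → ℂ} (hG : Continuous G) (hφ : Continuous φ)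
    (hφc : HasCompactSupport φ) (hsupp : tsupport φ ⊆ Set.Ioi 0)
    (hG2 : Integrable fun s => s ^ 2 * ‖G s‖ ^ 2)
    (hA : Integrable fun k => k * ‖∫ q, G (k - q) * φ q‖ ^ 2) :
    -((∫ s, s ^ 2 * ‖G s‖ ^ 2) * ∫ p, ‖φ p‖ ^ 2) ≤ ∫ k, k * ‖∫ q, G (k - q) * φ q‖ ^ 2 := by
  have hφ2 : Integrable fun p => ‖φ p‖ ^ 2 :=
    (by fun_prop : Continuous fun p => ‖φ p‖ ^ 2).integrable_of_hasCompactSupport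
      (hφc.comp_left (g := fun z => ‖z‖ ^ 2) (by simp))
  have hCS (k : ℝ) : ‖∫ q, G (k - q) * φ q‖ₑ ^ 2 ≤
      (∫⁻ q in Set.Ioi (0 : ℝ), ‖G (k - q)‖ₑ ^ 2) * ∫⁻ q, ‖φ q‖ₑ ^ 2 := by
    rw [← lintegral_indicator measurableSet_Ioi]
    have h1 : ‖∫ q, G (k - q) * φ q‖ₑ ≤
        ∫⁻ q, (Set.Ioi 0).indicator (fun q => ‖G (k - q)‖ₑ) q * ‖φ q‖ₑ := by
      refine (enorm_integral_le_lintegral_enorm _).trans (lintegral_mono fun q => ?_)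
      by_cases hq : 0 < q
      · simp [hq]
      · have : φ q = 0 := image_eq_zero_of_notMem_tsupport fun h => hq (hsupp h)
        simp [this]
    refine (pow_le_pow_left' h1 2).trans ((lintegral_mul_sq_le ?_ ?_).trans (le_of_eq ?_))
    · exact ((by fun_prop : Continuous fun q => G (k - q)).measurable.enorm.indicator
        measurableSet_Ioi).aemeasurable
    · fun_prop
    · congr 2
      ext q
      by_cases hq : 0 < q <;> simp [hq]
  have hneg : ∫⁻ k, ENNReal.ofReal (-(k * ‖∫ q, G (k - q) * φ q‖ ^ 2)) ≤
      ENNReal.ofReal ((∫ s, s ^ 2 * ‖G s‖ ^ 2) * ∫ p, ‖φ p‖ ^ 2) := by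
    rw [ENNReal.ofReal_mul (integral_nonneg fun s => by positivity),
      ofReal_integral_eq_lintegral_ofReal hG2 (.of_forall fun s => by positivity),
      ofReal_integral_eq_lintegral_ofReal hφ2 (.of_forall fun s => by positivity)]
    calc _ ≤ ∫⁻ k, ENNReal.ofReal (-k) * (∫⁻ q in Set.Ioi (0 : ℝ), ‖G (k - q)‖ₑ ^ 2) *
            ∫⁻ q, ‖φ q‖ₑ ^ 2 := by
          refine lintegral_mono fun k => ?_
          dsimp only
          rw [← neg_mul, ENNReal.ofReal_mul' (by positivity), mul_assoc,
            ENNReal.ofReal_pow (norm_nonneg _), ofReal_norm]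
          gcongr
          exact hCS k
      _ = (∫⁻ k, ENNReal.ofReal (-k) * (∫⁻ q in Set.Ioi (0 : ℝ), ‖G (k - q)‖ₑ ^ 2)) *
            ∫⁻ q, ‖φ q‖ₑ ^ 2 := by
          refine lintegral_mul_const' _ _ ?_
          have := hφ2.lintegral_lt_top.ne
          simpa [ENNReal.ofReal_pow, ofReal_norm] using this
      _ ≤ _ := by
          refine mul_le_mul' ((lintegral_neg_mul_lintegral_le
            (e := fun s => ‖G s‖ₑ ^ 2) (by fun_prop)).trans (le_of_eq ?_)) (le_of_eq ?_)
          · refine lintegral_congr fun s => ?_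
            rw [ENNReal.ofReal_mul (by positivity), ENNReal.ofReal_pow (norm_nonneg _), ofReal_norm]
          · refine lintegral_congr fun s => ?_
            rw [ENNReal.ofReal_pow (norm_nonneg _), ofReal_norm]
  rw [integral_eq_lintegral_pos_part_sub_lintegral_neg_part hA]
  have := ENNReal.toReal_le_of_le_ofReal (mul_nonneg (integral_nonneg fun s => by positivity)
    (integral_nonneg fun s => by positivity)) hneg
  linarith [ENNReal.toReal_nonneg (a := ∫⁻ k, ENNReal.ofReal (k * ‖∫ q, G (k - q) * φ q‖ ^ 2))]

lemma norm_mul_kernel_le {G : ℝ → ℂ} {C : ℝ} (hC : ∀ s, (1 + |s|) ^ 3 * ‖G s‖ ≤ C) (p k : ℝ) :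
    |k| * ‖G (p - k)‖ ≤ (1 + |p|) ^ 3 * C * (1 + k ^ 2)⁻¹ := by
  have h1 : 1 + |k| ≤ (1 + |p|) * (1 + |p - k|) := by
    have : |k| ≤ |p| + |p - k| := by
      have := abs_sub p (p - k)
      simpa using this
    nlinarith [abs_nonneg p, abs_nonneg (p - k)]
  have h2 : (1 + |k|) ^ 3 * ‖G (p - k)‖ ≤ (1 + |p|) ^ 3 * C := by
    calc _ ≤ ((1 + |p|) * (1 + |p - k|)) ^ 3 * ‖G (p - k)‖ := by gcongr
      _ = (1 + |p|) ^ 3 * ((1 + |p - k|) ^ 3 * ‖G (p - k)‖) := by ring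
      _ ≤ _ := by gcongr; exact hC _
  rw [← div_eq_mul_inv, le_div_iff₀ (by positivity)]
  refine le_trans ?_ h2
  have : |k| * (1 + k ^ 2) ≤ (1 + |k|) ^ 3 := by
    rw [← sq_abs]; nlinarith [abs_nonneg k, sq_nonneg |k|]
  nlinarith [norm_nonneg (G (p - k))]

lemma norm_kernel_le {G : ℝ → ℂ} {C : ℝ} (hC : ∀ s, (1 + |s|) ^ 3 * ‖G s‖ ≤ C) (s : ℝ) :
    ‖G s‖ ≤ C :=
  (le_mul_of_one_le_left (norm_nonneg _) (one_le_pow₀ (by simp))).trans (hC s)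

lemma integral_mul_kernel_mul_kernel {G H : ℝ → ℂ} {C : ℝ} (hG : Continuous G)
    (hC : ∀ s, (1 + |s|) ^ 3 * ‖G s‖ ≤ C) (hH : ∀ u, H u = ∫ s, G s * G (u - s)) (p q : ℝ) :
    ∫ k : ℝ, (k : ℂ) * G (p - k) * G (k - q) = ((p : ℂ) + q) / 2 * H (p - q) := by
  have hC0 : 0 ≤ C := (norm_nonneg _).trans (norm_kernel_le hC 0)
  have hint : Integrable fun k : ℝ => (k : ℂ) * G (p - k) * G (k - q) := by
    refine (((integrable_inv_one_add_sq).const_mul ((1 + |p|) ^ 3 * C)).mul_const C).mono'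
      (by fun_prop) (.of_forall fun k => ?_)
    rw [norm_mul, norm_mul, Complex.norm_real, Real.norm_eq_abs]
    exact mul_le_mul (norm_mul_kernel_le hC p k) (norm_kernel_le hC _) (norm_nonneg _)
      (by positivity)
  have hrefl : ∫ k : ℝ, (k : ℂ) * G (p - k) * G (k - q) =
      ∫ k : ℝ, ((p : ℂ) + q - k) * (G (p - k) * G (k - q)) := by
    rw [← integral_sub_left_eq_self _ volume (p + q)]
    refine integral_congr_ae (.of_forall fun k => ?_)
    simp only [show p - (p + q - k) = k - q by ring, show p + q - k - q = p - k by ring]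
    push_cast
    ring
  have hHpq : H (p - q) = ∫ k : ℝ, G (p - k) * G (k - q) := by
    rw [hH, ← integral_sub_left_eq_self _ volume p]
    refine integral_congr_ae (.of_forall fun k => ?_)
    simp only [show p - q - (p - k) = k - q by ring]
  have hint' : Integrable fun k : ℝ => ((p : ℂ) + q - k) * (G (p - k) * G (k - q)) := by
    have := hint.comp_sub_left (p + q)
    refine this.congr (.of_forall fun k => ?_)
    simp only [show p - (p + q - k) = k - q by ring, show p + q - k - q = p - k by ring]
    push_cast
    ring
  have hsum : (∫ k : ℝ, (k : ℂ) * G (p - k) * G (k - q)) +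
      ∫ k : ℝ, (k : ℂ) * G (p - k) * G (k - q) = ((p : ℂ) + q) * H (p - q) := by
    conv_lhs => arg 2; rw [hrefl]
    rw [← integral_add hint hint', hHpq, ← integral_const_mul]
    refine integral_congr_ae (.of_forall fun k => ?_)
    ring
  linear_combination hsum / 2

/-- The flux form of a self-convolution diagonalizes as a first moment. -/
lemma integral_integral_flux_eq {G H φ : ℝ → ℂ} {C : ℝ} (hG : Continuous G)
    (hC : ∀ s, (1 + |s|) ^ 3 * ‖G s‖ ≤ C) (hsymm : ∀ s, G (-s) = (starRingEnd ℂ) (G s))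
    (hH : ∀ u, H u = ∫ s, G s * G (u - s)) (hφ : Continuous φ) (hφc : HasCompactSupport φ) :
    (Integrable fun k => k * ‖∫ q, G (k - q) * φ q‖ ^ 2) ∧
    ∫ p : ℝ, ∫ q : ℝ, (starRingEnd ℂ) (φ p) * (((p : ℂ) + q) / 2) * H (p - q) * φ q =
      ((∫ k, k * ‖∫ q, G (k - q) * φ q‖ ^ 2 : ℝ) : ℂ) := by
  have hC0 : 0 ≤ C := (norm_nonneg _).trans (norm_kernel_le hC 0)
  set T : (ℝ × ℝ) × ℝ → ℂ := fun z =>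
    ((starRingEnd ℂ) (φ z.1.1) * φ z.1.2) * (z.2 * G (z.1.1 - z.2) * G (z.2 - z.1.2)) with hT
  have h1 : Integrable fun p => ‖φ p‖ * (1 + |p|) ^ 3 :=
    (by fun_prop : Continuous fun p => ‖φ p‖ * (1 + |p|) ^ 3).integrable_of_hasCompactSupport
      hφc.norm.mul_right
  have h2 : Integrable fun q => ‖φ q‖ := (hφ.integrable_of_hasCompactSupport hφc).norm
  have hTint : Integrable T (((volume : Measure ℝ).prod volume).prod volume) := by
    refine (((h1.mul_prod h2).const_mul (C * C)).mul_prod integrable_inv_one_add_sq).mono'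
      (by fun_prop) (.of_forall fun ⟨⟨p, q⟩, k⟩ => ?_)
    simp only [hT, norm_mul, RCLike.norm_conj, Complex.norm_real, Real.norm_eq_abs]
    calc _ ≤ ‖φ p‖ * ‖φ q‖ * ((1 + |p|) ^ 3 * C * (1 + k ^ 2)⁻¹ * C) := by
          refine mul_le_mul_of_nonneg_left (mul_le_mul (norm_mul_kernel_le hC p k)
            (norm_kernel_le hC _) (norm_nonneg _) (by positivity)) (by positivity)
      _ = _ := by ring
  have hsq (k : ℝ) : ∫ z : ℝ × ℝ, T (z, k) = ((k * ‖∫ q, G (k - q) * φ q‖ ^ 2 : ℝ) : ℂ) := by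
    have : (fun z : ℝ × ℝ => T (z, k)) = fun z =>
        (k : ℂ) * ((starRingEnd ℂ) (G (k - z.1) * φ z.1) * (G (k - z.2) * φ z.2)) := by
      ext z
      simp only [hT, map_mul, ← hsymm, neg_sub]
      ring
    rw [this, integral_const_mul, Measure.volume_eq_prod,
      integral_prod_mul (fun p => (starRingEnd ℂ) (G (k - p) * φ p)) (fun q => G (k - q) * φ q),
      integral_conj, RCLike.conj_mul]
    push_cast
    rfl
  constructor
  · have := hTint.integral_prod_right
    rw [← Measure.volume_eq_prod] at this
    simp_rw [hsq] at this
    exact this.re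
  · rw [← integral_complex_ofReal]
    simp_rw [← hsq]
    rw [Measure.volume_eq_prod,
      ← integral_integral_swap (f := fun w k => T (w, k)) (by simpa [Function.uncurry_def]),
      integral_prod _ hTint.integral_prod_left]
    refine integral_congr_ae (.of_forall fun p => integral_congr_ae (.of_forall fun q => ?_))
    simp only [hT]
    rw [integral_const_mul, integral_mul_kernel_mul_kernel hG hC hH]
    ring

lemma SchwartzMap.hasTemperateGrowth_comp_of_contDiffOn (f : 𝓢(ℝ, ℝ)) {F : ℝ → ℝ} {a b : ℝ}
    (hab : a < b) (hf : ∀ x, f x ∈ Set.Icc a b) (hF : ContDiffOn ℝ ∞ F (Set.Icc a b)) :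
    (F ∘ f).HasTemperateGrowth := by
  have hu := uniqueDiffOn_Icc hab
  refine Function.HasTemperateGrowth.comp' (Set.range_subset_iff.2 hf) hu hF (fun N => ?_)
    f.hasTemperateGrowth
  have hb (n : ℕ) : ∃ C, ∀ x ∈ Set.Icc a b, ‖iteratedFDerivWithin ℝ n F (Set.Icc a b) x‖ ≤ C :=
    isCompact_Icc.exists_bound_of_continuousOn
      (hF.continuousOn_iteratedFDerivWithin (by exact_mod_cast le_top) hu)
  choose C hC using hb
  refine ⟨0, ∑ n ∈ Finset.range (N + 1), |C n|, by positivity, fun n hn x hx => ?_⟩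
  rw [pow_zero, mul_one]
  exact (hC n x hx).trans ((le_abs_self _).trans
    (Finset.single_le_sum (f := fun n => |C n|) (fun i _ => abs_nonneg _)
      (Finset.mem_range.2 (by omega))))

lemma SchwartzMap.exists_eq_sqrt_add_sub_sqrt (f : 𝓢(ℝ, ℝ)) (hf : ∀ x, 0 ≤ f x) {ε : ℝ}
    (hε : 0 < ε) : ∃ g : 𝓢(ℝ, ℝ), ∀ x, g x = √(ε + f x) - √ε := by
  set B := SchwartzMap.seminorm ℝ 0 0 f
  have hB : 0 ≤ B := apply_nonneg _ _
  have hF : ContDiffOn ℝ ∞ (fun t => (√(ε + t) + √ε)⁻¹) (Set.Icc 0 (B + 1)) := by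
    intro t ht
    have : 0 < ε + t := by linarith [ht.1]
    refine ContDiffAt.contDiffWithinAt (ContDiffAt.inv ?_ (by positivity))
    exact ((contDiffAt_const.add contDiffAt_id).sqrt this.ne').add contDiffAt_const
  have hT := f.hasTemperateGrowth_comp_of_contDiffOn (by linarith) (fun x => ⟨hf x, by
    have := SchwartzMap.norm_le_seminorm ℝ f x
    rw [Real.norm_of_nonneg (hf x)] at this
    linarith⟩) hF
  refine ⟨SchwartzMap.smulLeftCLM ℝ ((fun t => (√(ε + t) + √ε)⁻¹) ∘ f) f, fun x => ?_⟩
  rw [SchwartzMap.smulLeftCLM_apply_apply hT, smul_eq_mul, Function.comp_apply,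
    inv_mul_eq_iff_eq_mul₀ (by positivity)]
  linarith [Real.sq_sqrt hε.le, Real.sq_sqrt (add_nonneg hε.le (hf x)),
    (by ring : (√(ε + f x) + √ε) * (√(ε + f x) - √ε) = √(ε + f x) ^ 2 - √ε ^ 2)]

/-- A nonnegative function with second derivative at most `M` satisfies `h'² ≤ 2Mh`. -/
lemma sq_deriv_le_of_deriv2_le {h : ℝ → ℝ} (hh : ContDiff ℝ 2 h) (h0 : ∀ x, 0 ≤ h x) {M : ℝ}
    (hM : ∀ x, deriv (deriv h) x ≤ M) (x : ℝ) : deriv h x ^ 2 ≤ 2 * M * h x := by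
  have hd : Differentiable ℝ h := hh.differentiable (by norm_num)
  have hd' : Differentiable ℝ (deriv h) := by
    have : ContDiff ℝ (1 + 1) h := hh
    exact (contDiff_succ_iff_deriv.1 this).2.2.differentiable (by norm_num)
  have h1 (y : ℝ) : HasDerivAt (fun y => M / 2 * y ^ 2 - h y) (M * y - deriv h y) y := by
    refine (((hasDerivAt_pow 2 y).const_mul (M / 2)).fun_sub (hd y).hasDerivAt).congr_deriv ?_
    simp
    ring
  have h1' : deriv (fun y => M / 2 * y ^ 2 - h y) = fun y => M * y - deriv h y :=
    funext fun y => (h1 y).deriv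
  have h2 (y : ℝ) : HasDerivAt (fun y => M * y - deriv h y) (M - deriv (deriv h) y) y := by
    simpa using ((hasDerivAt_id' y).const_mul M).fun_sub (hd' y).hasDerivAt
  have hconv : ConvexOn ℝ Set.univ (fun y => M / 2 * y ^ 2 - h y) := by
    refine convexOn_univ_of_deriv2_nonneg (fun y => (h1 y).differentiableAt) ?_ fun y => ?_
    · rw [h1']; exact fun y => (h2 y).differentiableAt
    · rw [Function.iterate_succ, Function.iterate_one, Function.comp_apply, h1', (h2 y).deriv]
      linarith [hM y]
  have key (t : ℝ) : 0 ≤ M / 2 * (t * t) + deriv h x * t + h x := by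
    have htan : (M / 2 * x ^ 2 - h x) + (M * x - deriv h x) * t ≤
        M / 2 * (x + t) ^ 2 - h (x + t) := by
      rcases lt_trichotomy t 0 with ht | ht | ht
      · have := hconv.slope_le_of_hasDerivAt (Set.mem_univ (x + t)) (Set.mem_univ x)
          (by linarith) (h1 x)
        rw [slope_def_field, div_le_iff₀ (by linarith)] at this
        linarith
      · simp [ht]
      · have := hconv.le_slope_of_hasDerivAt (Set.mem_univ x) (Set.mem_univ (x + t))
          (by linarith) (h1 x)
        rw [slope_def_field, le_div_iff₀ (by linarith)] at this
        linarith
    nlinarith [h0 (x + t)]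
  have := discrim_le_zero key
  rw [discrim] at this
  linarith

/-- A nonnegative Schwartz function has finite Fisher information. -/
lemma SchwartzMap.exists_integrable_sq_deriv_le (f : 𝓢(ℝ, ℝ)) (hf : ∀ x, 0 ≤ f x) :
    ∃ M : ℝ → ℝ, Integrable M ∧ ∀ x, deriv f x ^ 2 ≤ M x * f x := by
  have hw : (fun x : ℝ => 1 + x ^ 2).HasTemperateGrowth := by fun_prop
  set h : 𝓢(ℝ, ℝ) := SchwartzMap.smulLeftCLM ℝ (fun x : ℝ => 1 + x ^ 2) f
  have hh (x : ℝ) : h x = (1 + x ^ 2) * f x := by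
    simp [h, SchwartzMap.smulLeftCLM_apply_apply hw]
  set h2 := SchwartzMap.derivCLM ℝ ℝ (SchwartzMap.derivCLM ℝ ℝ h)
  have hh2 (x : ℝ) : deriv (deriv h) x = h2 x := by
    rw [SchwartzMap.derivCLM_apply]
    congr 1
  have hsq := sq_deriv_le_of_deriv2_le (h.smooth 2) (fun x => by rw [hh]; have := hf x; positivity)
    (M := SchwartzMap.seminorm ℝ 0 0 h2)
    (fun x => by rw [hh2]; exact (le_abs_self _).trans (SchwartzMap.norm_le_seminorm ℝ h2 x))
  set K := SchwartzMap.seminorm ℝ 0 0 h2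
  refine ⟨fun x => 4 * K * (1 + x ^ 2)⁻¹ + 2 * f x,
    (integrable_inv_one_add_sq.const_mul _).add (f.integrable.const_mul _), fun x => ?_⟩
  have hd : deriv h x = 2 * x * f x + (1 + x ^ 2) * deriv f x := by
    rw [show (h : ℝ → ℝ) = fun x => (1 + x ^ 2) * f x from funext hh]
    simpa using (((hasDerivAt_pow 2 x).const_add 1).fun_mul (f.hasDerivAt x)).deriv
  have hpos : 0 < 1 + x ^ 2 := by positivity
  have hx := hsq x
  rw [hd, hh] at hx
  have e : (4 * K * (1 + x ^ 2)⁻¹ + 2 * f x) * f x =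
      (4 * K * (1 + x ^ 2) * f x + 2 * (1 + x ^ 2) ^ 2 * f x ^ 2) / (1 + x ^ 2) ^ 2 := by
    field_simp
  rw [e, le_div_iff₀ (by positivity)]
  nlinarith [sq_nonneg (2 * (2 * x * f x) + (1 + x ^ 2) * deriv f x),
    mul_nonneg (sq_nonneg (1 - x ^ 2)) (sq_nonneg (f x))]

/-- The Fourier transform in angular-frequency convention. -/
noncomputable def angularFourier (g : 𝓢(ℝ, ℝ)) (k : ℝ) : ℂ :=
  ∫ x : ℝ, (g x : ℂ) * Complex.exp (-Complex.I * (k : ℂ) * (x : ℂ))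

/-- A real Schwartz function regarded as a complex one. -/
noncomputable def SchwartzMap.complexify (g : 𝓢(ℝ, ℝ)) : 𝓢(ℝ, ℂ) :=
  g.postcompCLM Complex.ofRealCLM

@[simp]
lemma SchwartzMap.complexify_apply (g : 𝓢(ℝ, ℝ)) (x : ℝ) : g.complexify x = g x := by
  simp [complexify]

lemma angularFourier_eq_fourier (g : 𝓢(ℝ, ℝ)) (k : ℝ) :
    angularFourier g k = 𝓕 g.complexify (k / (2 * π)) := by
  rw [SchwartzMap.fourier_coe, Real.fourier_real_eq_integral_exp_smul, angularFourier]
  refine integral_congr_ae (.of_forall fun x => ?_)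
  dsimp only
  rw [smul_eq_mul, mul_comm, SchwartzMap.complexify_apply]
  congr 2
  push_cast
  field_simp

lemma continuous_angularFourier (g : 𝓢(ℝ, ℝ)) : Continuous (angularFourier g) := by
  rw [funext (angularFourier_eq_fourier g)]
  exact (𝓕 g.complexify).continuous.comp (by fun_prop)

lemma norm_angularFourier_le (g : 𝓢(ℝ, ℝ)) (k : ℝ) : ‖angularFourier g k‖ ≤ ∫ x, |g x| := by
  refine (norm_integral_le_integral_norm _).trans (le_of_eq ?_)
  refine integral_congr_ae (.of_forall fun x => ?_)
  simp [Complex.norm_exp]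

lemma angularFourier_neg (g : 𝓢(ℝ, ℝ)) (k : ℝ) :
    angularFourier g (-k) = (starRingEnd ℂ) (angularFourier g k) := by
  rw [angularFourier, angularFourier, ← integral_conj]
  refine integral_congr_ae (.of_forall fun x => ?_)
  simp [← Complex.exp_conj]

lemma exists_pow_mul_norm_angularFourier_le (g : 𝓢(ℝ, ℝ)) (n : ℕ) :
    ∃ C, ∀ k, (1 + |k|) ^ n * ‖angularFourier g k‖ ≤ C := by
  have h := fun y => SchwartzMap.one_add_le_sup_seminorm_apply (𝕜 := ℂ) (m := (n, 0)) le_rfl le_rfl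
    (𝓕 g.complexify) y
  refine ⟨(2 * π) ^ n * _, fun k => le_trans ?_
    (mul_le_mul_of_nonneg_left (h (k / (2 * π))) (by positivity))⟩
  rw [angularFourier_eq_fourier, norm_iteratedFDeriv_zero, ← mul_assoc, ← mul_pow]
  gcongr
  rw [Real.norm_eq_abs, abs_div, abs_of_pos (by positivity : 0 < 2 * π), mul_add,
    mul_div_cancel₀ _ (by positivity)]
  linarith [pi_gt_three]

lemma angularFourier_sq {g h : 𝓢(ℝ, ℝ)} (hgh : ∀ x, h x = g x ^ 2) (u : ℝ) :
    angularFourier h u =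
      1 / (2 * π) * ∫ s, angularFourier g s * angularFourier g (u - s) := by
  set L := ContinuousLinearMap.mul ℂ ℂ
  have hneg (g : 𝓢(ℝ, ℝ)) (k : ℝ) : angularFourier g k = 𝓕⁻ g.complexify (-k / (2 * π)) := by
    rw [angularFourier_eq_fourier, SchwartzMap.fourier_coe, SchwartzMap.fourierInv_coe,
      Real.fourierInv_eq_fourier_neg, neg_div, neg_neg]
  have hconv : SchwartzMap.convolution L (𝓕⁻ g.complexify) (𝓕⁻ g.complexify) =
      𝓕⁻ h.complexify := by
    rw [← FourierTransform.fourierInv_fourier_eq (F := 𝓢(ℝ, ℂ))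
        (SchwartzMap.convolution L _ _),
      SchwartzMap.fourier_convolution]
    congr 1
    ext x
    simp [L, SchwartzMap.pairing_apply_apply, hgh, sq]
  rw [hneg, ← hconv, SchwartzMap.convolution_apply, MeasureTheory.convolution_def]
  simp_rw [hneg]
  have := Measure.integral_comp_div
    (fun t => 𝓕⁻ g.complexify t * 𝓕⁻ g.complexify (-u / (2 * π) - t)) (-(2 * π))
  have e (s : ℝ) : -(u - s) / (2 * π) = -u / (2 * π) - s / -(2 * π) := by field_simp; ring
  have e' (s : ℝ) : -s / (2 * π) = s / -(2 * π) := by field_simp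
  simp_rw [e, e'] at this ⊢
  rw [this, abs_neg, abs_of_pos (by positivity : 0 < 2 * π)]
  simp [L]
  field_simp

lemma integral_sq_mul_norm_angularFourier_sq (g : 𝓢(ℝ, ℝ)) :
    ∫ s, s ^ 2 * ‖angularFourier g s‖ ^ 2 = 2 * π * ∫ x, deriv g x ^ 2 := by
  set d := SchwartzMap.derivCLM ℂ ℂ g.complexify with hd
  have hdx (x : ℝ) : d x = (deriv g x : ℝ) := by
    rw [hd, SchwartzMap.derivCLM_apply]
    have := (g.hasDerivAt x).ofReal_comp.deriv
    rw [← this]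
    congr 1
  have hF (y : ℝ) : 𝓕 d y = (2 * π * Complex.I * y) * 𝓕 g.complexify y := by
    have hdf : (d : ℝ → ℂ) = deriv g.complexify := funext fun x => SchwartzMap.derivCLM_apply ..
    rw [SchwartzMap.fourier_coe, SchwartzMap.fourier_coe, hdf, Real.fourier_deriv
      g.complexify.integrable g.complexify.differentiable (hdf ▸ d.integrable)]
    rfl
  have hs (s : ℝ) : s ^ 2 * ‖angularFourier g s‖ ^ 2 = ‖𝓕 d (s / (2 * π))‖ ^ 2 := by
    rw [hF, angularFourier_eq_fourier, norm_mul, mul_pow]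
    congr 1
    simp [abs_of_pos pi_pos]
    field_simp
    rw [sq_abs]
  simp_rw [hs]
  rw [Measure.integral_comp_div (fun t => ‖𝓕 d t‖ ^ 2), SchwartzMap.integral_norm_sq_fourier,
    abs_of_pos (by positivity), smul_eq_mul]
  simp [hdx]

lemma integrable_flux {φ K : ℝ → ℂ} (hφ : Continuous φ) (hφc : HasCompactSupport φ)
    (hK : Continuous K) {B : ℝ} (hB : ∀ u, ‖K u‖ ≤ B) :
    Integrable (fun z : ℝ × ℝ =>
      (starRingEnd ℂ) (φ z.1) * (((z.1 : ℂ) + z.2) / 2) * K (z.1 - z.2) * φ z.2)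
      (volume.prod volume) ∧
    ‖∫ p : ℝ, ∫ q : ℝ, (starRingEnd ℂ) (φ p) * (((p : ℂ) + q) / 2) * K (p - q) * φ q‖ ≤
      B * (∫ p, ‖φ p‖ * (1 + |p|)) ^ 2 := by
  have h1 : Integrable fun p => ‖φ p‖ * (1 + |p|) :=
    (by fun_prop : Continuous fun p => ‖φ p‖ * (1 + |p|)).integrable_of_hasCompactSupport
      hφc.norm.mul_right
  have hdom := (h1.mul_prod h1).const_mul B
  have hle (z : ℝ × ℝ) :
      ‖(starRingEnd ℂ) (φ z.1) * (((z.1 : ℂ) + z.2) / 2) * K (z.1 - z.2) * φ z.2‖ ≤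
        B * (‖φ z.1‖ * (1 + |z.1|) * (‖φ z.2‖ * (1 + |z.2|))) := by
    have hpq : ‖((z.1 : ℂ) + z.2) / 2‖ ≤ (1 + |z.1|) * (1 + |z.2|) := by
      rw [← Complex.ofReal_add, norm_div, Complex.norm_real, Real.norm_eq_abs, Complex.norm_ofNat]
      nlinarith [abs_add_le z.1 z.2, abs_nonneg z.1, abs_nonneg z.2,
        mul_nonneg (abs_nonneg z.1) (abs_nonneg z.2)]
    rw [norm_mul, norm_mul, norm_mul, RCLike.norm_conj]
    calc _ ≤ ‖φ z.1‖ * ((1 + |z.1|) * (1 + |z.2|)) * B * ‖φ z.2‖ := by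
          gcongr
          exact hB _
      _ = _ := by ring
  have hint := hdom.mono' (by fun_prop) (.of_forall hle)
  refine ⟨hint, ?_⟩
  rw [integral_integral hint]
  refine (norm_integral_le_of_norm_le hdom (.of_forall hle)).trans (le_of_eq ?_)
  rw [integral_const_mul, integral_prod_mul (fun p => ‖φ p‖ * (1 + |p|))
    (fun p => ‖φ p‖ * (1 + |p|)), sq]

/-- The flux inequality for the weight `g²`, with constant the squared norm of `g'`. -/
lemma neg_le_re_flux_sq {g h : 𝓢(ℝ, ℝ)} (hgh : ∀ x, h x = g x ^ 2) {φ : ℝ → ℂ}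
    (hφ : Continuous φ) (hφc : HasCompactSupport φ) (hsupp : tsupport φ ⊆ Set.Ioi 0) :
    -((∫ x, deriv g x ^ 2) * ∫ p, ‖φ p‖ ^ 2) ≤
      (∫ p : ℝ, ∫ q : ℝ, (starRingEnd ℂ) (φ p) * (((p : ℂ) + q) / 2) *
        (1 / (2 * (π : ℂ)) * angularFourier h (p - q)) * φ q).re := by
  set G : ℝ → ℂ := fun k => 1 / (2 * (π : ℂ)) * angularFourier g k with hGdef
  have hGc : Continuous G := continuous_const.mul (continuous_angularFourier g)
  have hGn (k : ℝ) : ‖G k‖ = 1 / (2 * π) * ‖angularFourier g k‖ := by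
    simp [hGdef, abs_of_pos pi_pos]
  obtain ⟨C, hC⟩ := exists_pow_mul_norm_angularFourier_le g 3
  have hGC (s : ℝ) : (1 + |s|) ^ 3 * ‖G s‖ ≤ 1 / (2 * π) * C := by
    rw [hGn, mul_left_comm]
    gcongr
    exact hC s
  have hsymm (s : ℝ) : G (-s) = (starRingEnd ℂ) (G s) := by
    simp only [hGdef, angularFourier_neg, map_mul, map_div₀, map_one, Complex.conj_ofReal,
      map_ofNat]
  have hH (u : ℝ) :
      1 / (2 * (π : ℂ)) * angularFourier h u = ∫ s, G s * G (u - s) := by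
    have e (s : ℝ) : G s * G (u - s) = 1 / (2 * (π : ℂ)) * (1 / (2 * (π : ℂ))) *
        (angularFourier g s * angularFourier g (u - s)) := by
      simp only [hGdef]; ring
    simp_rw [e]
    rw [integral_const_mul, angularFourier_sq hgh, mul_assoc]
  obtain ⟨hA, heq⟩ := integral_integral_flux_eq hGc hGC hsymm hH hφ hφc
  have hG2 : Integrable fun s => s ^ 2 * ‖G s‖ ^ 2 := by
    refine (integrable_inv_one_add_sq.const_mul ((1 / (2 * π) * C) ^ 2)).mono' (by fun_prop)
      (.of_forall fun s => ?_)
    have h2 := pow_le_pow_left₀ (by positivity) (hGC s) 2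
    rw [Real.norm_of_nonneg (by positivity), ← div_eq_mul_inv, le_div_iff₀ (by positivity)]
    refine le_trans ?_ h2
    rw [mul_pow, ← pow_mul, mul_right_comm]
    gcongr
    have h0 := abs_nonneg s
    calc s ^ 2 * (1 + s ^ 2) ≤ (1 + |s|) ^ 2 * (1 + |s|) ^ 2 := by
          rw [← sq_abs]
          refine mul_le_mul ?_ ?_ (by positivity) (by positivity) <;> nlinarith
      _ = (1 + |s|) ^ 4 := by ring
      _ ≤ (1 + |s|) ^ (3 * 2) := pow_le_pow_right₀ (by linarith) (by norm_num)
  have hmom : ∫ s, s ^ 2 * ‖G s‖ ^ 2 ≤ ∫ x, deriv g x ^ 2 := by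
    have e (s : ℝ) : s ^ 2 * ‖G s‖ ^ 2 =
        (1 / (2 * π)) ^ 2 * (s ^ 2 * ‖angularFourier g s‖ ^ 2) := by
      rw [hGn]; ring
    simp_rw [e]
    rw [integral_const_mul, integral_sq_mul_norm_angularFourier_sq, ← mul_assoc]
    refine mul_le_of_le_one_left (integral_nonneg fun x => sq_nonneg _) ?_
    rw [show (1 / (2 * π)) ^ 2 * (2 * π) = 1 / (2 * π) by field_simp,
      div_le_one (by positivity)]
    linarith [pi_gt_three]
  rw [heq, Complex.ofReal_re]
  refine le_trans ?_ (neg_le_integral_mul_norm_sq hGc hφ hφc hsupp hG2 hA)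
  exact neg_le_neg (mul_le_mul_of_nonneg_right hmom (integral_nonneg fun p => by positivity))

/-- The elementary inequality `√a ≤ (w⁻¹ + w a) / 2`. -/
lemma sqrt_le_half_inv_add_mul {a w : ℝ} (ha : 0 ≤ a) (hw : 0 < w) :
    √a ≤ 1 / 2 * (w⁻¹ + w * a) := by
  have h := sq_nonneg (w * √a - 1)
  have e : 1 / 2 * (w⁻¹ + w * a) - √a = (w * √a - 1) ^ 2 / (2 * w) := by
    field_simp
    nlinarith [Real.sq_sqrt ha]
  have : 0 ≤ (w * √a - 1) ^ 2 / (2 * w) := by positivity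
  linarith

lemma SchwartzMap.exists_integral_sqrt_regularization_le (f : 𝓢(ℝ, ℝ)) (hf : ∀ x, 0 ≤ f x) :
    ∃ c S : ℝ, 0 ≤ c ∧ ∀ (ε : ℝ) (_ : 0 < ε) (g : 𝓢(ℝ, ℝ)) (_ : ∀ x, g x = √(ε + f x) - √ε),
      ∫ x, deriv g x ^ 2 ≤ c ∧ ∫ x, |g x| ≤ S := by
  obtain ⟨M, hM, hfM⟩ := f.exists_integrable_sq_deriv_le hf
  have hw : (fun x : ℝ => 1 + x ^ 2).HasTemperateGrowth := by fun_prop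
  set wf : 𝓢(ℝ, ℝ) := SchwartzMap.smulLeftCLM ℝ (fun x : ℝ => 1 + x ^ 2) f
  have hwf (x : ℝ) : wf x = (1 + x ^ 2) * f x := by
    simp [wf, SchwartzMap.smulLeftCLM_apply_apply hw]
  refine ⟨∫ x, |M x|, ∫ x, 1 / 2 * ((1 + x ^ 2)⁻¹ + wf x),
    integral_nonneg fun x => abs_nonneg _, fun ε hε g hg => ⟨?_, ?_⟩⟩
  · refine integral_mono_of_nonneg (.of_forall fun x => sq_nonneg _) hM.abs (.of_forall fun x => ?_)
    have hpos : 0 < ε + f x := by linarith [hf x]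
    have hd : deriv g x = deriv f x / (2 * √(ε + f x)) := by
      rw [show (g : ℝ → ℝ) = fun x => √(ε + f x) - √ε from funext hg]
      exact ((((f.hasDerivAt x).const_add ε).sqrt hpos.ne').sub_const _).deriv
    dsimp only
    rw [hd, div_pow, mul_pow, Real.sq_sqrt hpos.le, div_le_iff₀ (by positivity)]
    nlinarith [hfM x, le_abs_self (M x), hf x, abs_nonneg (M x),
      mul_le_mul_of_nonneg_right (le_abs_self (M x)) (hf x), mul_nonneg (abs_nonneg (M x)) (hf x),
      mul_nonneg (abs_nonneg (M x)) hε.le]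
  · refine integral_mono g.integrable.abs
      ((integrable_inv_one_add_sq.add wf.integrable).const_mul _) fun x => ?_
    have h1 : √(ε + f x) ≤ √ε + √(f x) := Real.sqrt_le_iff.2 ⟨by positivity, by
      nlinarith [Real.sq_sqrt hε.le, Real.sq_sqrt (hf x),
        mul_nonneg (Real.sqrt_nonneg ε) (Real.sqrt_nonneg (f x))]⟩
    have h2 : √ε ≤ √(ε + f x) := Real.sqrt_le_sqrt (by linarith [hf x])
    have h3 := sqrt_le_half_inv_add_mul (hf x) (by positivity : 0 < 1 + x ^ 2)
    dsimp only
    rw [hwf, hg, abs_of_nonneg (by linarith)]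
    linarith

/-- **Eveson–Fewster–Verch quantum inequality.**
For every nonnegative Schwartz function `f` there is a constant `c_f ≥ 0` such that for
every smooth momentum wavefunction `φ` with compact support in the positive half-line,
the smeared flux expectation
`⟨J_f⟩_φ = ∫∫ conj(φ(p)) ((p+q)/2) (1/(2π)) f̂(p−q) φ(q) dp dq`
satisfies `⟨J_f⟩_φ ≥ −c_f ‖φ‖²`. -/
theorem eveson_fewster_verch_quantum_inequality
    (f : SchwartzMap ℝ ℝ) (hf : ∀ x, 0 ≤ f x)
    (fhat : ℝ → ℂ)
    (hfhat : ∀ k : ℝ, fhat k = ∫ x : ℝ, (f x : ℂ) * Complex.exp (-Complex.I * (k : ℂ) * (x : ℂ))) :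
    ∃ c : ℝ, 0 ≤ c ∧
      ∀ φ : ℝ → ℂ,
        ContDiff ℝ (⊤ : ℕ∞) φ → HasCompactSupport φ → tsupport φ ⊆ Set.Ioi (0 : ℝ) →
        (∫ p : ℝ, ∫ q : ℝ,
            (starRingEnd ℂ) (φ p) * (((p : ℂ) + (q : ℂ)) / 2) * (1 / (2 * (π : ℂ))) *
              fhat (p - q) * φ q).re ≥ -c * ∫ p : ℝ, ‖φ p‖ ^ 2 := by
  obtain ⟨c, S, hc, hcS⟩ := f.exists_integral_sqrt_regularization_le hf
  refine ⟨c, hc, fun φ hφs hφc hsupp => ?_⟩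
  have hφ := hφs.continuous
  set N := ∫ p : ℝ, ‖φ p‖ ^ 2
  have hN : 0 ≤ N := integral_nonneg fun p => by positivity
  set D := (∫ p, ‖φ p‖ * (1 + |p|)) ^ 2
  have key (δ : ℝ) (hδ : 0 < δ) : -c * N - δ * (S * D) ≤
      (∫ p : ℝ, ∫ q : ℝ, (starRingEnd ℂ) (φ p) * (((p : ℂ) + (q : ℂ)) / 2) *
        (1 / (2 * (π : ℂ))) * fhat (p - q) * φ q).re := by
    obtain ⟨g, hg⟩ := f.exists_eq_sqrt_add_sub_sqrt hf (sq_pos_of_pos hδ)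
    obtain ⟨hgc, hgS⟩ := hcS _ (sq_pos_of_pos hδ) g hg
    rw [Real.sqrt_sq hδ.le] at hg
    set h : 𝓢(ℝ, ℝ) := f - (2 * δ) • g
    have hh (x : ℝ) : h x = g x ^ 2 := by
      have := Real.sq_sqrt (by have := hf x; positivity : 0 ≤ δ ^ 2 + f x)
      simp only [h, sub_apply, smul_apply, smul_eq_mul, hg]
      linear_combination -this
    set H : ℝ → ℂ := fun u => 1 / (2 * (π : ℂ)) * angularFourier h u with hHdef
    set E : ℝ → ℂ := fun u => (δ / π : ℝ) * angularFourier g u with hEdef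
    have hsplit (u : ℝ) : 1 / (2 * (π : ℂ)) * fhat u = H u + E u := by
      have hi (g : 𝓢(ℝ, ℝ)) :
          Integrable fun x : ℝ => (g x : ℂ) * Complex.exp (-Complex.I * (u : ℂ) * (x : ℂ)) := by
        refine g.integrable.norm.mono' ?_ (.of_forall fun x => ?_)
        · have := g.continuous
          exact (by fun_prop : Continuous fun x : ℝ =>
            (g x : ℂ) * Complex.exp (-Complex.I * (u : ℂ) * (x : ℂ))).aestronglyMeasurable
        · simp [Complex.norm_exp]
      have : angularFourier h u = fhat u - 2 * δ * angularFourier g u := by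
        rw [hfhat, angularFourier, angularFourier, ← integral_const_mul,
          ← integral_sub (hi f) ((hi g).const_mul _)]
        refine integral_congr_ae (.of_forall fun x => ?_)
        simp only [h, sub_apply, smul_apply, smul_eq_mul]
        push_cast
        ring
      simp only [hHdef, hEdef, this]
      push_cast
      field_simp
      ring
    have hHc : Continuous H := continuous_const.mul (continuous_angularFourier h)
    have hEc : Continuous E := continuous_const.mul (continuous_angularFourier g)
    have hEb (u : ℝ) : ‖E u‖ ≤ δ * S := by
      rw [hEdef, norm_mul, Complex.norm_real, Real.norm_of_nonneg (by positivity)]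
      gcongr
      · exact div_le_self hδ.le (by linarith [pi_gt_three])
      · exact (norm_angularFourier_le g u).trans hgS
    have hHb (u : ℝ) : ‖H u‖ ≤ ‖1 / (2 * (π : ℂ))‖ * ∫ x, |h x| := by
      rw [hHdef, norm_mul]
      gcongr
      exact norm_angularFourier_le h u
    obtain ⟨hHi, -⟩ := integrable_flux hφ hφc hHc hHb
    obtain ⟨hEi, hEn⟩ := integrable_flux hφ hφc hEc hEb
    have hadd : ∫ p : ℝ, ∫ q : ℝ, (starRingEnd ℂ) (φ p) * (((p : ℂ) + (q : ℂ)) / 2) *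
          (1 / (2 * (π : ℂ))) * fhat (p - q) * φ q =
        (∫ p : ℝ, ∫ q : ℝ, (starRingEnd ℂ) (φ p) * (((p : ℂ) + q) / 2) * H (p - q) * φ q) +
        ∫ p : ℝ, ∫ q : ℝ, (starRingEnd ℂ) (φ p) * (((p : ℂ) + q) / 2) * E (p - q) * φ q := by
      rw [← integral_integral_add hHi hEi]
      refine integral_congr_ae (.of_forall fun p => integral_congr_ae (.of_forall fun q => ?_))
      dsimp only
      rw [mul_assoc _ (1 / (2 * (π : ℂ))), hsplit]
      ring
    have hHlow := neg_le_re_flux_sq hh hφ hφc hsupp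
    have hElow := (neg_le_of_abs_le ((Complex.abs_re_le_norm _).trans hEn))
    rw [hadd, Complex.add_re]
    have := mul_le_mul_of_nonneg_right hgc hN
    linarith
  have hlim : Filter.Tendsto (fun δ : ℝ => -c * N - δ * (S * D)) (nhdsWithin 0 (Set.Ioi 0))
      (nhds (-c * N)) := by
    refine Filter.Tendsto.mono_left ?_ nhdsWithin_le_nhds
    exact (by fun_prop : Continuous fun δ : ℝ => -c * N - δ * (S * D)).tendsto' _ _ (by simp)
  exact le_of_tendsto hlim (by filter_upwards [self_mem_nhdsWithin] with δ hδ using key δ hδ)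
end

section
/- Let φ be a Schwartz function on ℝ, let F⁻¹ denote the inverse Fourier transform, and for t ∈ ℝ define φ_t(p) = exp(−i p² t / 2) φ(p) and ψ_t = F⁻¹ φ_t (the position-space wavefunction). Then for each x ∈ ℝ the map t ↦ ψ_t(x) is differentiable and ψ_t solves the free Schrödinger equation: i · ∂_t ψ_t(x) = −(1/2) · ∂_x² ψ_t(x) for all t, x ∈ ℝ. Moreover ‖φ_t‖_{L²} = ‖φ‖_{L²} for all t. -/
open MeasureTheory Real

/-- Differentiation under the integral sign for an oscillatory integral whose phase
`a p * s + b p` is affine in the parameter `s`. -/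
theorem hasDerivAt_integral_exp_affine_phase {α : Type*} [MeasurableSpace α] {μ : Measure α}
    {a b : α → ℝ} {g : α → ℂ} (ha : Measurable a) (hb : Measurable b) (hg : Integrable g μ)
    (hag : Integrable (fun p => (a p : ℂ) * g p) μ) (s : ℝ) :
    HasDerivAt (fun r : ℝ => ∫ p, Complex.exp (Complex.I * ((a p * r + b p : ℝ) : ℂ)) * g p ∂μ)
      (Complex.I *
        ∫ p, Complex.exp (Complex.I * ((a p * s + b p : ℝ) : ℂ)) * ((a p : ℂ) * g p) ∂μ) s := by
  have norm_phase (y : ℝ) : ‖Complex.exp (Complex.I * (y : ℂ))‖ = 1 :=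
    Complex.norm_exp_I_mul_ofReal y
  have phase_meas (r : ℝ) :
      AEStronglyMeasurable (fun p => Complex.exp (Complex.I * ((a p * r + b p : ℝ) : ℂ))) μ :=
    Measurable.aestronglyMeasurable (by fun_prop)
  have key := hasDerivAt_integral_of_dominated_loc_of_deriv_le (μ := μ) (x₀ := s)
    (F := fun r p => Complex.exp (Complex.I * ((a p * r + b p : ℝ) : ℂ)) * g p)
    (F' := fun r p =>
      Complex.I * (Complex.exp (Complex.I * ((a p * r + b p : ℝ) : ℂ)) * ((a p : ℂ) * g p)))
    (bound := fun p => ‖(a p : ℂ) * g p‖) Filter.univ_mem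
    (Filter.Eventually.of_forall fun r => (phase_meas r).mul hg.aestronglyMeasurable)
    (hg.mono ((phase_meas s).mul hg.aestronglyMeasurable)
      (Filter.Eventually.of_forall fun p => by rw [norm_mul, norm_phase, one_mul]))
    (((phase_meas s).mul hag.aestronglyMeasurable).const_mul Complex.I)
    (Filter.Eventually.of_forall fun p r _ => by
      rw [norm_mul, Complex.norm_I, one_mul, norm_mul, norm_phase, one_mul])
    hag.norm
    (Filter.Eventually.of_forall fun p r _ => by
      have h₁ : HasDerivAt (fun r : ℝ => a p * r + b p) (a p) r := by
        simpa using ((hasDerivAt_id r).const_mul (a p)).add_const (b p)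
      have h₂ := ((h₁.ofReal_comp.const_mul Complex.I).cexp).mul_const (g p)
      exact h₂.congr_deriv (by ring))
  simpa only [integral_const_mul] using key.2

theorem SchwartzMap.integrable_ofReal_pow_mul (φ : SchwartzMap ℝ ℂ) (k : ℕ) :
    Integrable (fun p : ℝ => (p : ℂ) ^ k * φ p) := by
  refine (φ.integrable_pow_mul volume k).mono
    (Continuous.aestronglyMeasurable (by fun_prop)) (Filter.Eventually.of_forall fun p => ?_)
  simp

/-- **The free time evolution solves the free Schrödinger equation and is unitary.**
For a Schwartz momentum wavefunction `φ`, set `φ_t(p) = exp(−i p² t/2) φ(p)` and let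
`ψ_t = F⁻¹ φ_t` be the position wavefunction, with convention
`(F⁻¹φ)(x) = (2π)^{−1/2} ∫ e^{ipx} φ(p) dp`. Then `t ↦ ψ_t(x)` is differentiable,
`i ∂_t ψ_t(x) = −(1/2) ∂_x² ψ_t(x)`, and `‖φ_t‖_{L²} = ‖φ‖_{L²}`. -/
theorem free_schroedinger_evolution
    (φ : SchwartzMap ℝ ℂ)
    (φt : ℝ → ℝ → ℂ)
    (hφt : ∀ t p, φt t p = Complex.exp (-Complex.I * (p : ℂ) ^ 2 * (t : ℂ) / 2) * φ p)
    (ψ : ℝ → ℝ → ℂ)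
    (hψ : ∀ t x, ψ t x = ((2 * π : ℝ) ^ (-(1 / 2 : ℝ)) : ℝ) *
      ∫ p : ℝ, Complex.exp (Complex.I * (p : ℂ) * (x : ℂ)) * φt t p) :
    (∀ x : ℝ, Differentiable ℝ (fun t : ℝ => ψ t x)) ∧
    (∀ t x : ℝ,
      Complex.I * deriv (fun s : ℝ => ψ s x) t =
        -(1 / 2 : ℂ) * deriv (fun y : ℝ => deriv (fun z : ℝ => ψ t z) y) x) ∧
    (∀ t : ℝ, (∫ p : ℝ, ‖φt t p‖ ^ 2) = ∫ p : ℝ, ‖φ p‖ ^ 2) := by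
  have int₀ : Integrable (fun p : ℝ => φ p) := φ.integrable
  have int₁ : Integrable (fun p : ℝ => ((p : ℝ) : ℂ) * φ p) := by
    simpa using φ.integrable_ofReal_pow_mul 1
  have int₂ : Integrable (fun p : ℝ => (p : ℂ) ^ 2 * φ p) := φ.integrable_ofReal_pow_mul 2
  set c : ℂ := (((2 * π : ℝ) ^ (-(1 / 2 : ℝ)) : ℝ) : ℂ)
  let phase : ℝ → ℝ → ℝ → ℂ := fun t x p =>
    Complex.exp (Complex.I * ((p * x + -(p ^ 2 * t / 2) : ℝ) : ℂ))
  have hψ' (t x : ℝ) : ψ t x = c * ∫ p, phase t x p * φ p := by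
    rw [hψ]
    congr 2
    ext p
    rw [hφt, ← mul_assoc, ← Complex.exp_add]
    congr 2
    push_cast
    ring
  have time_deriv (t x : ℝ) : HasDerivAt (fun s => ψ s x)
      (c * (Complex.I * (-(1 / 2) * ∫ p, phase t x p * ((p : ℂ) ^ 2 * φ p)))) t := by
    have h := (hasDerivAt_integral_exp_affine_phase (μ := volume)
      (a := fun p : ℝ => -(p ^ 2 / 2)) (b := fun p => p * x) (g := φ)
      (by fun_prop) (by fun_prop) int₀
      ((int₂.const_mul (-(1 / 2))).congr (Filter.Eventually.of_forall fun p => by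
        push_cast
        ring)) t).const_mul c
    have h_fun : (fun s => ψ s x) = fun s => c * ∫ p : ℝ,
        Complex.exp (Complex.I * ((-(p ^ 2 / 2) * s + p * x : ℝ) : ℂ)) * φ p := by
      ext s
      rw [hψ']
      congr 2
      ext p
      simp only [phase]
      congr 4
      ring
    rw [h_fun]
    refine h.congr_deriv ?_
    rw [← integral_const_mul (-(1 / 2) : ℂ)]
    congr 2
    refine integral_congr_ae (Filter.Eventually.of_forall fun p => ?_)
    simp only [phase]
    rw [show p * x + -(p ^ 2 * t / 2) = -(p ^ 2 / 2) * t + p * x by ring]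
    push_cast
    ring
  have space_deriv (t x : ℝ) : HasDerivAt (fun z => ψ t z)
      (c * (Complex.I * ∫ p, phase t x p * ((p : ℂ) * φ p))) x := by
    have h := (hasDerivAt_integral_exp_affine_phase (μ := volume)
      (a := fun p : ℝ => p) (b := fun p => -(p ^ 2 * t / 2)) (g := φ)
      (by fun_prop) (by fun_prop) int₀ int₁ x).const_mul c
    simpa only [hψ'] using h
  have space_deriv_two (t x : ℝ) : HasDerivAt (fun y => deriv (fun z => ψ t z) y)
      (c * (Complex.I * (Complex.I * ∫ p, phase t x p * ((p : ℂ) ^ 2 * φ p)))) x := by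
    have h := ((hasDerivAt_integral_exp_affine_phase (μ := volume)
      (a := fun p : ℝ => p) (b := fun p => -(p ^ 2 * t / 2)) (g := fun p => (p : ℂ) * φ p)
      (by fun_prop) (by fun_prop) int₁
      (by simpa only [pow_two, mul_assoc] using int₂) x).const_mul Complex.I).const_mul c
    simp only [(space_deriv t _).deriv]
    simpa only [pow_two, mul_assoc, phase] using h
  refine ⟨fun x t => (time_deriv t x).differentiableAt, fun t x => ?_, fun t => ?_⟩
  · rw [(time_deriv t x).deriv, (space_deriv_two t x).deriv]
    ring
  · congr 1
    ext p
    rw [hφt, show -Complex.I * (p : ℂ) ^ 2 * (t : ℂ) / 2 =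
      Complex.I * ((-(p ^ 2 * t / 2) : ℝ) : ℂ) by push_cast; ring,
      norm_mul, Complex.norm_exp_I_mul_ofReal, one_mul]
end
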